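/- (Lemma 4.7(ii), elastic observability-type inequality) Consider the full Dirichlet boundary conditions. Let λ ∈ ℝ, Û ∈ ℋ, and let U = (φ,Φ,ψ,Ψ,θ,η,ξ,ζ) ∈ D(𝒜) satisfy the resolvent equation iλU − 𝒜U = Û. Defining 𝓙(ψ) = |ψx(0)|² + |ψx(L)|², one has 𝓙(ψ) ≤ c‖U‖²_ℋ + c‖U‖_ℋ ‖Û‖_ℋ + c‖U‖_ℋ ‖ξx‖ for some structural constant c > 0 independent of λ, U and Û. -/

import Mathlib

/-!
Shared setting: thermoelastic Timoshenko–Gurtin–Pipkin system on (0,L),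
history space framework of Dafermos.  Functions on (0,L) are represented as
maps `ℝ → ℂ`, memory variables as maps `ℝ → ℝ → ℂ` (first argument the
history variable `s`, second the space variable `x`).
-/

open MeasureTheory Set Filter

noncomputable section

namespace TGP

/-- L² norm squared on (0,L). -/
def L2normSq (L : ℝ) (f : ℝ → ℂ) : ℝ := ∫ x in Ioo 0 L, ‖f x‖ ^ 2

/-- L² norm on (0,L). -/
def L2norm (L : ℝ) (f : ℝ → ℂ) : ℝ := Real.sqrt (L2normSq L f)

/-- L² inner product on (0,L). -/
def L2inner (L : ℝ) (f g : ℝ → ℂ) : ℂ :=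
  ∫ x in Ioo 0 L, (starRingEnd ℂ) (g x) * f x

/-- Weighted memory-space norm squared: `∫₀^∞ w(s) ‖ηx(s)‖² ds`. -/
def MnormSq (L : ℝ) (w : ℝ → ℝ) (η : ℝ → ℝ → ℂ) : ℝ :=
  ∫ s in Ioi (0 : ℝ), w s * L2normSq L (deriv (η s))

/-- Weighted memory-space norm. -/
def Mnorm (L : ℝ) (w : ℝ → ℝ) (η : ℝ → ℝ → ℂ) : ℝ := Real.sqrt (MnormSq L w η)

/-- Weighted memory-space inner product: `∫₀^∞ w(s) ⟨η1x(s), η2x(s)⟩ ds`. -/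
def Minner (L : ℝ) (w : ℝ → ℝ) (η1 η2 : ℝ → ℝ → ℂ) : ℂ :=
  ∫ s in Ioi (0 : ℝ), (w s : ℂ) * L2inner L (deriv (η1 s)) (deriv (η2 s))

/-- The functional `Γ[η] = ∫₀^∞ (−w'(s)) ‖ηx(s)‖² ds`. -/
def Gam (L : ℝ) (w : ℝ → ℝ) (η : ℝ → ℝ → ℂ) : ℝ :=
  ∫ s in Ioi (0 : ℝ), (-(deriv w s)) * L2normSq L (deriv (η s))

/-- Structural parameters of the model, including the assumptions on the
memory kernels μ and ν. -/
structure Params where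
  L : ℝ
  rho1 : ℝ
  rho2 : ℝ
  rho3 : ℝ
  rho4 : ℝ
  k : ℝ
  b : ℝ
  gamma : ℝ
  sigma : ℝ
  w1 : ℝ
  w2 : ℝ
  delta1 : ℝ
  delta2 : ℝ
  mu : ℝ → ℝ
  nu : ℝ → ℝ
  hL : 0 < L
  hrho1 : 0 < rho1
  hrho2 : 0 < rho2
  hrho3 : 0 < rho3
  hrho4 : 0 < rho4
  hk : 0 < k
  hb : 0 < b
  hgamma : 0 < gamma
  hsigma : 0 < sigma
  hw1 : 0 < w1
  hw2 : 0 < w2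
  hdelta1 : 0 < delta1
  hdelta2 : 0 < delta2
  hmu_nonneg : ∀ s ∈ Ioi (0 : ℝ), 0 ≤ mu s
  hnu_nonneg : ∀ s ∈ Ioi (0 : ℝ), 0 ≤ nu s
  hmu_mono : AntitoneOn mu (Ioi 0)
  hnu_mono : AntitoneOn nu (Ioi 0)
  hmu_int : IntegrableOn mu (Ioi 0)
  hnu_int : IntegrableOn nu (Ioi 0)
  -- absolute continuity on (0,∞), expressed through the fundamental
  -- theorem of calculus for the a.e. derivative
  hmu_ac : ∀ a c : ℝ, 0 < a → a ≤ c → mu c - mu a = ∫ s in a..c, deriv mu s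
  hnu_ac : ∀ a c : ℝ, 0 < a → a ≤ c → nu c - nu a = ∫ s in a..c, deriv nu s
  -- the Dafermos conditions μ' + δ₁ μ ≤ 0, ν' + δ₂ ν ≤ 0 a.e.
  hmu_daf : ∀ᵐ s ∂(volume.restrict (Ioi (0 : ℝ))), deriv mu s + delta1 * mu s ≤ 0
  hnu_daf : ∀ᵐ s ∂(volume.restrict (Ioi (0 : ℝ))), deriv nu s + delta2 * nu s ≤ 0

/-- The two kinds of boundary conditions considered. -/
inductive BC
  | mixed     -- mixed Dirichlet–Neumann boundary conditions
  | dirichlet -- full Dirichlet boundary conditions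

/-- A state `U = (φ, Φ, ψ, Ψ, θ, η, ξ, ζ)`. -/
structure State where
  phi : ℝ → ℂ
  Phi : ℝ → ℂ
  psi : ℝ → ℂ
  Psi : ℝ → ℂ
  theta : ℝ → ℂ
  eta : ℝ → ℝ → ℂ
  xi : ℝ → ℂ
  zeta : ℝ → ℝ → ℂ

instance : Sub State :=
  ⟨fun U V =>
    { phi := U.phi - V.phi
      Phi := U.Phi - V.Phi
      psi := U.psi - V.psi
      Psi := U.Psi - V.Psi
      theta := U.theta - V.theta
      eta := fun s => U.eta s - V.eta s
      xi := U.xi - V.xi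
      zeta := fun s => U.zeta s - V.zeta s }⟩

instance : SMul ℂ State :=
  ⟨fun a U =>
    { phi := a • U.phi
      Phi := a • U.Phi
      psi := a • U.psi
      Psi := a • U.Psi
      theta := a • U.theta
      eta := fun s => a • U.eta s
      xi := a • U.xi
      zeta := fun s => a • U.zeta s }⟩

/-- Membership in L²(0,L). -/
def memL2 (L : ℝ) (f : ℝ → ℂ) : Prop :=
  AEStronglyMeasurable f (volume.restrict (Ioo 0 L)) ∧
  IntegrableOn (fun x => ‖f x‖ ^ 2) (Ioo 0 L)

/-- Zero mean value on (0,L) (membership in L²_*). -/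
def zeroMean (L : ℝ) (f : ℝ → ℂ) : Prop := (∫ x in Ioo 0 L, f x) = 0

/-- Membership in H¹(0,L). -/
def memH1 (L : ℝ) (f : ℝ → ℂ) : Prop :=
  ContinuousOn f (Icc 0 L) ∧ (∀ x ∈ Ioo 0 L, DifferentiableAt ℝ f x) ∧
  memL2 L f ∧ memL2 L (deriv f)

/-- Membership in H¹₀(0,L). -/
def memH10 (L : ℝ) (f : ℝ → ℂ) : Prop := memH1 L f ∧ f 0 = 0 ∧ f L = 0

/-- Membership in H¹_*(0,L) = H¹ ∩ L²_*. -/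
def memH1star (L : ℝ) (f : ℝ → ℂ) : Prop := memH1 L f ∧ zeroMean L f

/-- Membership in H²(0,L). -/
def memH2 (L : ℝ) (f : ℝ → ℂ) : Prop := memH1 L f ∧ memH1 L (deriv f)

/-- Membership in the memory space ℳ = L²_μ((0,∞); H¹_*) (mixed case) or
ℳ = L²_μ((0,∞); H¹₀) (Dirichlet case). -/
def memMS (P : Params) (bc : BC) (η : ℝ → ℝ → ℂ) : Prop :=
  (∀ s ∈ Ioi (0 : ℝ),
    match bc with
    | BC.mixed => memH1star P.L (η s)
    | BC.dirichlet => memH10 P.L (η s)) ∧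
  IntegrableOn (fun s => P.mu s * L2normSq P.L (deriv (η s))) (Ioi 0)

/-- Membership in the memory space 𝒩 = L²_ν((0,∞); H¹₀). -/
def memNS (P : Params) (ζ : ℝ → ℝ → ℂ) : Prop :=
  (∀ s ∈ Ioi (0 : ℝ), memH10 P.L (ζ s)) ∧
  IntegrableOn (fun s => P.nu s * L2normSq P.L (deriv (ζ s))) (Ioi 0)

/-- Derivative with respect to the history variable s. -/
def sDeriv (η : ℝ → ℝ → ℂ) : ℝ → ℝ → ℂ := fun s x => deriv (fun r => η r x) s

/-- The generator `T = −∂s` of the right-translation semigroup. -/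
def Top (η : ℝ → ℝ → ℂ) : ℝ → ℝ → ℂ := fun s x => -(sDeriv η s x)

/-- Membership in D(T) ⊂ ℳ : η' ∈ ℳ and ‖ηx(s)‖ → 0 as s → 0⁺. -/
def memDTM (P : Params) (bc : BC) (η : ℝ → ℝ → ℂ) : Prop :=
  memMS P bc η ∧ memMS P bc (sDeriv η) ∧
  Tendsto (fun s => L2norm P.L (deriv (η s))) (nhdsWithin 0 (Ioi 0)) (nhds 0)

/-- Membership in D(T) ⊂ 𝒩 : ζ' ∈ 𝒩 and ‖ζx(s)‖ → 0 as s → 0⁺. -/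
def memDTN (P : Params) (ζ : ℝ → ℝ → ℂ) : Prop :=
  memNS P ζ ∧ memNS P (sDeriv ζ) ∧
  Tendsto (fun s => L2norm P.L (deriv (ζ s))) (nhdsWithin 0 (Ioi 0)) (nhds 0)

/-- Membership in the state space ℋ. -/
def memHS (P : Params) (bc : BC) (U : State) : Prop :=
  memH10 P.L U.phi ∧ memL2 P.L U.Phi ∧
  (match bc with
   | BC.mixed =>
      memH1star P.L U.psi ∧ memL2 P.L U.Psi ∧ zeroMean P.L U.Psi ∧
      memL2 P.L U.theta ∧ zeroMean P.L U.theta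
   | BC.dirichlet =>
      memH10 P.L U.psi ∧ memL2 P.L U.Psi ∧ memL2 P.L U.theta) ∧
  memMS P bc U.eta ∧ memL2 P.L U.xi ∧ memNS P U.zeta

/-- The squared norm on ℋ. -/
def hnormSq (P : Params) (U : State) : ℝ :=
  P.k * L2normSq P.L (fun x => deriv U.phi x + U.psi x) +
  P.rho1 * L2normSq P.L U.Phi +
  P.b * L2normSq P.L (deriv U.psi) +
  P.rho2 * L2normSq P.L U.Psi +
  P.rho3 * L2normSq P.L U.theta +
  P.w1 * MnormSq P.L P.mu U.eta +
  P.rho4 * L2normSq P.L U.xi +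
  P.w2 * MnormSq P.L P.nu U.zeta

/-- The norm on ℋ. -/
def hnorm (P : Params) (U : State) : ℝ := Real.sqrt (hnormSq P U)

/-- The inner product on ℋ. -/
def hinner (P : Params) (U V : State) : ℂ :=
  (P.k : ℂ) * L2inner P.L (fun x => deriv U.phi x + U.psi x)
      (fun x => deriv V.phi x + V.psi x) +
  (P.rho1 : ℂ) * L2inner P.L U.Phi V.Phi +
  (P.b : ℂ) * L2inner P.L (deriv U.psi) (deriv V.psi) +
  (P.rho2 : ℂ) * L2inner P.L U.Psi V.Psi +
  (P.rho3 : ℂ) * L2inner P.L U.theta V.theta +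
  (P.w1 : ℂ) * Minner P.L P.mu U.eta V.eta +
  (P.rho4 : ℂ) * L2inner P.L U.xi V.xi +
  (P.w2 : ℂ) * Minner P.L P.nu U.zeta V.zeta

/-- `x ↦ ∫₀^∞ μ(s) η(s,x) ds`. -/
def muInt (P : Params) (η : ℝ → ℝ → ℂ) : ℝ → ℂ :=
  fun x => ∫ s in Ioi (0 : ℝ), (P.mu s : ℂ) * η s x

/-- `x ↦ ∫₀^∞ ν(s) ζ(s,x) ds`. -/
def nuInt (P : Params) (ζ : ℝ → ℝ → ℂ) : ℝ → ℂ :=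
  fun x => ∫ s in Ioi (0 : ℝ), (P.nu s : ℂ) * ζ s x

/-- The Timoshenko–Gurtin–Pipkin operator 𝒜. -/
def Aop (P : Params) (U : State) : State where
  phi := U.Phi
  Phi := fun x =>
    ((P.k / P.rho1 : ℝ) : ℂ) * deriv (fun y => deriv U.phi y + U.psi y) x -
    ((P.gamma / P.rho1 : ℝ) : ℂ) * deriv U.theta x
  psi := U.Psi
  Psi := fun x =>
    ((P.b / P.rho2 : ℝ) : ℂ) * deriv (deriv U.psi) x -
    ((P.k / P.rho2 : ℝ) : ℂ) * (deriv U.phi x + U.psi x) +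
    ((P.gamma / P.rho2 : ℝ) : ℂ) * U.theta x -
    ((P.sigma / P.rho2 : ℝ) : ℂ) * deriv U.xi x
  theta := fun x =>
    ((P.w1 / P.rho3 : ℝ) : ℂ) *
      (∫ s in Ioi (0 : ℝ), (P.mu s : ℂ) * deriv (deriv (U.eta s)) x) -
    ((P.gamma / P.rho3 : ℝ) : ℂ) * (deriv U.Phi x + U.Psi x)
  eta := fun s x => Top U.eta s x + U.theta x
  xi := fun x =>
    ((P.w2 / P.rho4 : ℝ) : ℂ) *
      (∫ s in Ioi (0 : ℝ), (P.nu s : ℂ) * deriv (deriv (U.zeta s)) x) -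
    ((P.sigma / P.rho4 : ℝ) : ℂ) * deriv U.Psi x
  zeta := fun s x => Top U.zeta s x + U.xi x

/-- The domain D(𝒜) of the operator 𝒜. -/
def memDomA (P : Params) (bc : BC) (U : State) : Prop :=
  memHS P bc U ∧ memH2 P.L U.phi ∧ memH10 P.L U.Phi ∧ memH10 P.L U.xi ∧
  memH2 P.L (nuInt P U.zeta) ∧ memDTM P bc U.eta ∧ memDTN P U.zeta ∧
  (match bc with
   | BC.mixed =>
      memH10 P.L (deriv U.psi) ∧
      memH10 P.L (fun x => ∫ s in Ioi (0 : ℝ), (P.mu s : ℂ) * deriv (U.eta s) x) ∧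
      memH1star P.L U.Psi ∧ memH1star P.L U.theta
   | BC.dirichlet =>
      memH2 P.L U.psi ∧ memH10 P.L U.Psi ∧ memH10 P.L U.theta ∧
      memH2 P.L (muInt P U.eta))

/-- a.e. equality on (0,L). -/
def aeeqL (L : ℝ) (f g : ℝ → ℂ) : Prop :=
  ∀ᵐ x ∂(volume.restrict (Ioo 0 L)), f x = g x

/-- Equality of two states as elements of ℋ (componentwise, in the respective
norms of the factor spaces). -/
def StateEqAE (P : Params) (U V : State) : Prop :=
  aeeqL P.L (fun x => deriv U.phi x + U.psi x) (fun x => deriv V.phi x + V.psi x) ∧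
  aeeqL P.L U.Phi V.Phi ∧
  aeeqL P.L (deriv U.psi) (deriv V.psi) ∧
  aeeqL P.L U.Psi V.Psi ∧
  aeeqL P.L U.theta V.theta ∧
  (∀ᵐ s ∂(volume.restrict (Ioi (0 : ℝ))), aeeqL P.L (deriv (U.eta s)) (deriv (V.eta s))) ∧
  aeeqL P.L U.xi V.xi ∧
  (∀ᵐ s ∂(volume.restrict (Ioi (0 : ℝ))), aeeqL P.L (deriv (U.zeta s)) (deriv (V.zeta s)))

/-- The resolvent equation `iλU − 𝒜U = Û` (equality in ℋ). -/
def resolventEq (P : Params) (lam : ℝ) (U Uhat : State) : Prop :=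
  StateEqAE P (((Complex.I * (lam : ℂ)) • U) - Aop P U) Uhat

/-- `α(x) = ∫₀^∞ μ(s) ηx(x,s) ds`. -/
def alphaF (P : Params) (U : State) : ℝ → ℂ :=
  fun x => ∫ s in Ioi (0 : ℝ), (P.mu s : ℂ) * deriv (U.eta s) x

/-- `β(x) = ∫₀^∞ ν(s) ζx(x,s) ds`. -/
def betaF (P : Params) (U : State) : ℝ → ℂ :=
  fun x => ∫ s in Ioi (0 : ℝ), (P.nu s : ℂ) * deriv (U.zeta s) x

/-- `𝒫(φ,ψ,α) = |α(L)||φx(L)+ψ(L)| + |α(0)||φx(0)+ψ(0)|`. -/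
def Pterm (P : Params) (U : State) : ℝ :=
  ‖alphaF P U P.L‖ * ‖deriv U.phi P.L + U.psi P.L‖ +
  ‖alphaF P U 0‖ * ‖deriv U.phi 0 + U.psi 0‖

/-- `𝒬(ψ,β) = |β(L)||ψx(L)| + |β(0)||ψx(0)|`. -/
def Qterm (P : Params) (U : State) : ℝ :=
  ‖betaF P U P.L‖ * ‖deriv U.psi P.L‖ + ‖betaF P U 0‖ * ‖deriv U.psi 0‖

/-- `𝓘(φ,ψ) = |φx(0)+ψ(0)|² + |φx(L)+ψ(L)|²`. -/
def Iterm (P : Params) (U : State) : ℝ :=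
  ‖deriv U.phi 0 + U.psi 0‖ ^ 2 + ‖deriv U.phi P.L + U.psi P.L‖ ^ 2

/-- `𝓙(ψ) = |ψx(0)|² + |ψx(L)|²`. -/
def Jterm (P : Params) (U : State) : ℝ :=
  ‖deriv U.psi 0‖ ^ 2 + ‖deriv U.psi P.L‖ ^ 2

/-- `S` is the contraction C₀-semigroup on ℋ generated by 𝒜. -/
def IsGenSemigroup (P : Params) (bc : BC) (S : ℝ → State → State) : Prop :=
  (∀ t, 0 ≤ t → ∀ U, memHS P bc U → memHS P bc (S t U)) ∧
  (∀ U, memHS P bc U → StateEqAE P (S 0 U) U) ∧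
  (∀ t s, 0 ≤ t → 0 ≤ s → ∀ U, memHS P bc U →
    StateEqAE P (S (t + s) U) (S t (S s U))) ∧
  (∀ t, 0 ≤ t → ∀ U, memHS P bc U → hnorm P (S t U) ≤ hnorm P U) ∧
  (∀ U, memHS P bc U →
    Tendsto (fun t => hnorm P (S t U - U)) (nhdsWithin 0 (Ioi 0)) (nhds 0)) ∧
  (∀ U, memDomA P bc U → ∀ t, 0 ≤ t → memDomA P bc (S t U) ∧
    Tendsto (fun h : ℝ =>
        hnorm P (((h⁻¹ : ℝ) : ℂ) • (S (t + h) U - S t U) - Aop P (S t U)))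
      (nhdsWithin 0 (Ioi 0)) (nhds 0))

/-- Continuity on [0,∞) with values in ℋ. -/
def ContH (P : Params) (F : ℝ → State) : Prop :=
  ∀ t, 0 ≤ t →
    Tendsto (fun r => hnorm P (F r - F t)) (nhdsWithin t (Ici 0)) (nhds 0)

/-- `G` is the (right) derivative of `F` on [0,∞) in the norm of ℋ. -/
def HasHDeriv (P : Params) (F G : ℝ → State) : Prop :=
  ∀ t, 0 ≤ t →
    Tendsto (fun h : ℝ =>
        hnorm P (((h⁻¹ : ℝ) : ℂ) • (F (t + h) - F t) - G t))
      (nhdsWithin 0 (Ioi 0)) (nhds 0)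

/-- `F ∈ Cᵏ([0,∞), ℋ)`. -/
def CkH (P : Params) : ℕ → (ℝ → State) → Prop
  | 0, F => ContH P F
  | (n + 1), F => ContH P F ∧ ∃ G, HasHDeriv P F G ∧ CkH P n G

/-- Membership in D(𝒜ⁿ). -/
def memDomIter (P : Params) (bc : BC) : ℕ → State → Prop
  | 0, U => memHS P bc U
  | (n + 1), U => memDomA P bc U ∧ memDomIter P bc n (Aop P U)

/-! ### Square integrable functions on the interval -/

theorem memL2.memLp {L : ℝ} {f : ℝ → ℂ} (hf : memL2 L f) :
    MemLp f 2 (volume.restrict (Ioo 0 L)) :=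
  (memLp_two_iff_integrable_sq_norm hf.1).2 hf.2

theorem memL2.add {L : ℝ} {f g : ℝ → ℂ} (hf : memL2 L f) (hg : memL2 L g) :
    memL2 L (fun x => f x + g x) :=
  ⟨hf.1.add hg.1, (memLp_two_iff_integrable_sq_norm (hf.1.add hg.1)).1 (hf.memLp.add hg.memLp)⟩

theorem memL2.integrable_norm_mul {L : ℝ} {f g : ℝ → ℂ} (hf : memL2 L f) (hg : memL2 L g) :
    IntegrableOn (fun x => ‖f x‖ * ‖g x‖) (Ioo 0 L) :=
  hf.memLp.norm.integrable_mul hg.memLp.norm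

theorem memL2.integrable_inner {L : ℝ} {f g : ℝ → ℂ} (hf : memL2 L f) (hg : memL2 L g) :
    IntegrableOn (fun x => inner ℝ (f x) (g x)) (Ioo 0 L) :=
  (hf.integrable_norm_mul hg).mono' (hf.1.inner hg.1)
    (Eventually.of_forall fun x => norm_inner_le_norm (f x) (g x))

theorem L2normSq_nonneg (L : ℝ) (f : ℝ → ℂ) : 0 ≤ L2normSq L f :=
  integral_nonneg fun _ => sq_nonneg _

theorem L2norm_nonneg (L : ℝ) (f : ℝ → ℂ) : 0 ≤ L2norm L f := Real.sqrt_nonneg _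

/-- The Cauchy–Schwarz inequality on `(0, L)`. -/
theorem integral_norm_mul_le {L : ℝ} {f g : ℝ → ℂ} (hf : memL2 L f) (hg : memL2 L g) :
    ∫ x in Ioo 0 L, ‖f x‖ * ‖g x‖ ≤ L2norm L f * L2norm L g := by
  have h := integral_mul_le_Lp_mul_Lq_of_nonneg (μ := volume.restrict (Ioo 0 L))
    Real.HolderConjugate.two_two
    (Eventually.of_forall fun x => norm_nonneg (f x))
    (Eventually.of_forall fun x => norm_nonneg (g x))
    (by simpa using hf.memLp.norm) (by simpa using hg.memLp.norm)
  simpa [L2norm, L2normSq, Real.sqrt_eq_rpow] using h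

/-! ### The energy norm -/

theorem MnormSq_nonneg {L : ℝ} {w : ℝ → ℝ} (hw : ∀ s ∈ Ioi (0 : ℝ), 0 ≤ w s)
    (η : ℝ → ℝ → ℂ) : 0 ≤ MnormSq L w η :=
  setIntegral_nonneg measurableSet_Ioi fun s hs => mul_nonneg (hw s hs) (L2normSq_nonneg _ _)

/-- Each of the components controlling the elastic part, and the sum of the energies of `ψ`
and `Ψ`, is bounded by the energy. -/
theorem component_le_hnormSq (P : Params) (U : State) :
    P.k * L2normSq P.L (fun x => deriv U.phi x + U.psi x) ≤ hnormSq P U ∧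
    P.b * L2normSq P.L (deriv U.psi) ≤ hnormSq P U ∧
    P.rho2 * L2normSq P.L U.Psi ≤ hnormSq P U ∧
    P.rho3 * L2normSq P.L U.theta ≤ hnormSq P U ∧
    P.b * L2normSq P.L (deriv U.psi) + P.rho2 * L2normSq P.L U.Psi ≤ hnormSq P U := by
  have h1 := mul_nonneg P.hk.le (L2normSq_nonneg P.L (fun x => deriv U.phi x + U.psi x))
  have h2 := mul_nonneg P.hrho1.le (L2normSq_nonneg P.L U.Phi)
  have h3 := mul_nonneg P.hb.le (L2normSq_nonneg P.L (deriv U.psi))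
  have h4 := mul_nonneg P.hrho2.le (L2normSq_nonneg P.L U.Psi)
  have h5 := mul_nonneg P.hrho3.le (L2normSq_nonneg P.L U.theta)
  have h6 := mul_nonneg P.hw1.le (MnormSq_nonneg (L := P.L) P.hmu_nonneg U.eta)
  have h7 := mul_nonneg P.hrho4.le (L2normSq_nonneg P.L U.xi)
  have h8 := mul_nonneg P.hw2.le (MnormSq_nonneg (L := P.L) P.hnu_nonneg U.zeta)
  unfold hnormSq
  refine ⟨?_, ?_, ?_, ?_, ?_⟩ <;> linarith

theorem hnormSq_nonneg (P : Params) (U : State) : 0 ≤ hnormSq P U :=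
  (mul_nonneg P.hk.le (L2normSq_nonneg _ _)).trans (component_le_hnormSq P U).1

theorem L2norm_le_of_mul_le {L a : ℝ} (ha : 0 < a) {f : ℝ → ℂ} {P : Params} {U : State}
    (h : a * L2normSq L f ≤ hnormSq P U) : L2norm L f ≤ (Real.sqrt a)⁻¹ * hnorm P U := by
  rw [inv_mul_eq_div, le_div_iff₀ (Real.sqrt_pos.2 ha), mul_comm, L2norm, hnorm,
    ← Real.sqrt_mul ha.le]
  exact Real.sqrt_le_sqrt h

/-- A structural constant dominating the embedding constants of the elastic components. -/
def embedConst (P : Params) : ℝ :=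
  (Real.sqrt P.k)⁻¹ + (Real.sqrt P.b)⁻¹ + (Real.sqrt P.rho2)⁻¹ + (Real.sqrt P.rho3)⁻¹

theorem embedConst_nonneg (P : Params) : 0 ≤ embedConst P := by
  unfold embedConst; positivity

theorem L2norm_le_embedConst (P : Params) (U : State) :
    L2norm P.L (fun x => deriv U.phi x + U.psi x) ≤ embedConst P * hnorm P U ∧
    L2norm P.L (deriv U.psi) ≤ embedConst P * hnorm P U ∧
    L2norm P.L U.Psi ≤ embedConst P * hnorm P U ∧
    L2norm P.L U.theta ≤ embedConst P * hnorm P U := by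
  obtain ⟨h1, h2, h3, h4, -⟩ := component_le_hnormSq P U
  have hN : 0 ≤ hnorm P U := Real.sqrt_nonneg _
  have e1 : 0 ≤ (Real.sqrt P.k)⁻¹ := by positivity
  have e2 : 0 ≤ (Real.sqrt P.b)⁻¹ := by positivity
  have e3 : 0 ≤ (Real.sqrt P.rho2)⁻¹ := by positivity
  have e4 : 0 ≤ (Real.sqrt P.rho3)⁻¹ := by positivity
  refine ⟨(L2norm_le_of_mul_le P.hk h1).trans ?_, (L2norm_le_of_mul_le P.hb h2).trans ?_,
    (L2norm_le_of_mul_le P.hrho2 h3).trans ?_, (L2norm_le_of_mul_le P.hrho3 h4).trans ?_⟩ <;>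
  · refine mul_le_mul_of_nonneg_right ?_ hN
    unfold embedConst
    linarith

/-! ### The multiplier identity -/

/-- Weighting `a‖f‖² + d‖g‖²` by `x - L/2` expresses its boundary values as an integral. -/
theorem integral_multiplier {L a d : ℝ} (hL : 0 < L) {f g : ℝ → ℂ} (hf : memH1 L f)
    (hg : memH10 L g) :
    IntegrableOn (fun x => (a * ‖f x‖ ^ 2 + d * ‖g x‖ ^ 2) + (x - L / 2) *
      (a * (2 * inner ℝ (f x) (deriv f x)) + d * (2 * inner ℝ (g x) (deriv g x)))) (Ioo 0 L) ∧
    ∫ x in Ioo 0 L, ((a * ‖f x‖ ^ 2 + d * ‖g x‖ ^ 2) + (x - L / 2) *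
      (a * (2 * inner ℝ (f x) (deriv f x)) + d * (2 * inner ℝ (g x) (deriv g x)))) =
      L / 2 * (a * (‖f 0‖ ^ 2 + ‖f L‖ ^ 2)) := by
  obtain ⟨hfc, hfd, hf2, hf2'⟩ := hf
  obtain ⟨⟨hgc, hgd, hg2, hg2'⟩, hg0, hgL⟩ := hg
  have hI : IntegrableOn (fun x => (a * ‖f x‖ ^ 2 + d * ‖g x‖ ^ 2) + (x - L / 2) *
      (a * (2 * inner ℝ (f x) (deriv f x)) + d * (2 * inner ℝ (g x) (deriv g x))))
      (Ioo 0 L) := by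
    refine ((hf2.2.const_mul a).add (hg2.2.const_mul d)).add ?_
    refine Integrable.bdd_mul (c := L / 2)
      ((((hf2.integrable_inner hf2').const_mul 2).const_mul a).add
        (((hg2.integrable_inner hg2').const_mul 2).const_mul d))
      (by fun_prop) ?_
    filter_upwards [ae_restrict_mem measurableSet_Ioo] with x hx
    rw [Real.norm_eq_abs, abs_le]
    constructor <;> linarith [hx.1, hx.2]
  refine ⟨hI, ?_⟩
  have h := intervalIntegral.integral_eq_sub_of_hasDerivAt_of_le
    (f := fun x => (x - L / 2) * (a * ‖f x‖ ^ 2 + d * ‖g x‖ ^ 2))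
    (f' := fun x => (a * ‖f x‖ ^ 2 + d * ‖g x‖ ^ 2) + (x - L / 2) *
      (a * (2 * inner ℝ (f x) (deriv f x)) + d * (2 * inner ℝ (g x) (deriv g x)))) hL.le
    (by fun_prop)
    (fun x hx => by
      have h1 := (hfd x hx).hasDerivAt.norm_sq.const_mul a
      have h2 := (hgd x hx).hasDerivAt.norm_sq.const_mul d
      have h3 := ((hasDerivAt_id x).sub_const (L / 2)).mul (h1.add h2)
      exact h3.congr_deriv (by simp))
    ((intervalIntegrable_iff_integrableOn_Ioo_of_le hL.le).2 hI)
  rw [intervalIntegral.integral_of_le hL.le, integral_Ioc_eq_integral_Ioo] at h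
  rw [h, hg0, hgL]
  simp
  ring

/-- The pointwise form of the resolvent equation tested against the multiplier: the
terms containing `lam` cancel. -/
theorem re_resolvent_le {lam b r k γ σ : ℝ} (hr : 0 < r) (hk : 0 < k) (hγ : 0 < γ)
    (hσ : 0 < σ) {z z' p p' e t y F G : ℂ}
    (hψ : Complex.I * lam * z - p' = F)
    (hΨ : Complex.I * lam * p -
      (((b / r : ℝ) : ℂ) * z' - ((k / r : ℝ) : ℂ) * e + ((γ / r : ℝ) : ℂ) * t -
        ((σ / r : ℝ) : ℂ) * y) = G) :
    |b * (2 * inner ℝ z z') + r * (2 * inner ℝ p p')| ≤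
      2 * (k * (‖e‖ * ‖z‖) + γ * (‖t‖ * ‖z‖) + σ * (‖y‖ * ‖z‖) + r * (‖G‖ * ‖z‖) +
        r * (‖p‖ * ‖F‖)) := by
  have hrc : (r : ℂ) ≠ 0 := by exact_mod_cast hr.ne'
  have hz' : (b : ℂ) * z' = Complex.I * lam * r * p + k * e - γ * t + σ * y - r * G := by
    rw [← hΨ]
    push_cast
    field_simp
    ring
  have hp' : p' = Complex.I * lam * z - F := by rw [← hψ]; ring
  have key : b * (2 * inner ℝ z z') + r * (2 * inner ℝ p p') =
      2 * (k * inner ℝ e z - γ * inner ℝ t z + σ * inner ℝ y z - r * inner ℝ G z -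
        r * inner ℝ p F) := by
    have h1 : b * inner ℝ z z' = inner ℝ z ((b : ℂ) * z') := by
      simp [Complex.inner]; ring
    have : b * (2 * inner ℝ z z') = 2 * inner ℝ z ((b : ℂ) * z') := by rw [← h1]; ring
    rw [this, hz', hp']
    simp [Complex.inner]
    ring
  rw [key]
  have a1 := abs_le.1 (abs_real_inner_le_norm e z)
  have a2 := abs_le.1 (abs_real_inner_le_norm t z)
  have a3 := abs_le.1 (abs_real_inner_le_norm y z)
  have a4 := abs_le.1 (abs_real_inner_le_norm G z)
  have a5 := abs_le.1 (abs_real_inner_le_norm p F)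
  have l1 := mul_le_mul_of_nonneg_left a1.1 hk.le
  have u1 := mul_le_mul_of_nonneg_left a1.2 hk.le
  have l2 := mul_le_mul_of_nonneg_left a2.1 hγ.le
  have u2 := mul_le_mul_of_nonneg_left a2.2 hγ.le
  have l3 := mul_le_mul_of_nonneg_left a3.1 hσ.le
  have u3 := mul_le_mul_of_nonneg_left a3.2 hσ.le
  have l4 := mul_le_mul_of_nonneg_left a4.1 hr.le
  have u4 := mul_le_mul_of_nonneg_left a4.2 hr.le
  have l5 := mul_le_mul_of_nonneg_left a5.1 hr.le
  have u5 := mul_le_mul_of_nonneg_left a5.2 hr.le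
  rw [abs_le]
  constructor <;> linarith

/-- The boundary energy of `ψ` in terms of the `L²` norms of the components. -/
theorem Jterm_le (P : Params) {lam : ℝ} {U Uhat : State} (hU : memDomA P BC.dirichlet U)
    (hUhat : memHS P BC.dirichlet Uhat) (hres : resolventEq P lam U Uhat) :
    P.L / 2 * (P.b * Jterm P U) ≤
      P.b * L2normSq P.L (deriv U.psi) + P.rho2 * L2normSq P.L U.Psi +
      P.L * (P.k * (L2norm P.L (fun x => deriv U.phi x + U.psi x) * L2norm P.L (deriv U.psi)) +
        P.gamma * (L2norm P.L U.theta * L2norm P.L (deriv U.psi)) +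
        P.sigma * (L2norm P.L (deriv U.xi) * L2norm P.L (deriv U.psi)) +
        P.rho2 * (L2norm P.L Uhat.Psi * L2norm P.L (deriv U.psi)) +
        P.rho2 * (L2norm P.L U.Psi * L2norm P.L (deriv Uhat.psi))) := by
  obtain ⟨⟨hphi, -, -, -, -, -⟩, -, -, hxi, -, -, -, ⟨hpsi, hψx⟩, hPsi, htheta, -⟩ := hU
  obtain ⟨-, -, ⟨hpsih, hPsih, -⟩, -⟩ := hUhat
  obtain ⟨-, -, e3, e4, -⟩ := hres
  have hz : memL2 P.L (deriv U.psi) := hψx.2.2.1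
  have hp : memL2 P.L U.Psi := hPsi.1.2.2.1
  have he : memL2 P.L (fun x => deriv U.phi x + U.psi x) := hphi.1.2.2.2.add hpsi.2.2.1
  have ht : memL2 P.L U.theta := htheta.1.2.2.1
  have hy : memL2 P.L (deriv U.xi) := hxi.1.2.2.2
  have hF : memL2 P.L (deriv Uhat.psi) := hpsih.1.2.2.2
  have i1 := (he.integrable_norm_mul hz).const_mul P.k
  have i2 := (ht.integrable_norm_mul hz).const_mul P.gamma
  have i3 := (hy.integrable_norm_mul hz).const_mul P.sigma
  have i4 := (hPsih.integrable_norm_mul hz).const_mul P.rho2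
  have i5 := (hp.integrable_norm_mul hF).const_mul P.rho2
  have j1 := hz.2.const_mul P.b
  have j2 := hp.2.const_mul P.rho2
  obtain ⟨hI, hEq⟩ := integral_multiplier (a := P.b) (d := P.rho2) P.hL hψx hPsi
  have hS := (((i1.add i2).add i3).add i4).add i5
  have hmono := integral_mono_ae hI ((j1.add j2).add (hS.const_mul P.L)) (by
    filter_upwards [e3, e4, ae_restrict_mem measurableSet_Ioo] with x h3 h4 hx
    have hd : deriv ((Complex.I * (lam : ℂ)) • U.psi - U.Psi) x =
        Complex.I * lam * deriv U.psi x - deriv U.Psi x :=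
      (((hpsi.2.1 x hx).hasDerivAt.const_smul (Complex.I * (lam : ℂ))).sub
        (hPsi.1.2.1 x hx).hasDerivAt).deriv
    have hb := re_resolvent_le (b := P.b) P.hrho2 P.hk P.hgamma P.hsigma (hd.symm.trans h3) h4
    have hq : |x - P.L / 2| ≤ P.L / 2 := by
      rw [abs_le]; constructor <;> linarith [hx.1, hx.2]
    have hm := (le_abs_self _).trans ((abs_mul _ _).trans_le
      (mul_le_mul hq hb (abs_nonneg _) (by linarith [P.hL])))
    simp only [Pi.add_apply]
    linarith)
  rw [hEq] at hmono
  refine hmono.trans ?_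
  have hsum : ∫ x in Ioo 0 P.L, ((((P.b * ‖deriv U.psi x‖ ^ 2 + P.rho2 * ‖U.Psi x‖ ^ 2) +
      P.L * (P.k * (‖deriv U.phi x + U.psi x‖ * ‖deriv U.psi x‖) +
        P.gamma * (‖U.theta x‖ * ‖deriv U.psi x‖) +
        P.sigma * (‖deriv U.xi x‖ * ‖deriv U.psi x‖) +
        P.rho2 * (‖Uhat.Psi x‖ * ‖deriv U.psi x‖) +
        P.rho2 * (‖U.Psi x‖ * ‖deriv Uhat.psi x‖))))) =
      P.b * L2normSq P.L (deriv U.psi) + P.rho2 * L2normSq P.L U.Psi +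
      P.L * (P.k * (∫ x in Ioo 0 P.L, ‖deriv U.phi x + U.psi x‖ * ‖deriv U.psi x‖) +
        P.gamma * (∫ x in Ioo 0 P.L, ‖U.theta x‖ * ‖deriv U.psi x‖) +
        P.sigma * (∫ x in Ioo 0 P.L, ‖deriv U.xi x‖ * ‖deriv U.psi x‖) +
        P.rho2 * (∫ x in Ioo 0 P.L, ‖Uhat.Psi x‖ * ‖deriv U.psi x‖) +
        P.rho2 * (∫ x in Ioo 0 P.L, ‖U.Psi x‖ * ‖deriv Uhat.psi x‖)) := by
    refine (integral_add' (j1.add j2) (hS.const_mul P.L)).trans ?_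
    rw [integral_add' j1 j2, integral_const_mul, integral_const_mul, integral_const_mul,
      integral_add' (((i1.add i2).add i3).add i4) i5, integral_add' ((i1.add i2).add i3) i4,
      integral_add' (i1.add i2) i3, integral_add' i1 i2, integral_const_mul,
      integral_const_mul, integral_const_mul, integral_const_mul, integral_const_mul]
    rfl
  refine hsum.le.trans ?_
  have := P.hL
  have := P.hk
  have := P.hgamma
  have := P.hsigma
  have := P.hrho2
  gcongr
  · exact integral_norm_mul_le he hz
  · exact integral_norm_mul_le ht hz
  · exact integral_norm_mul_le hy hz
  · exact integral_norm_mul_le hPsih hz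
  · exact integral_norm_mul_le hp hF

/-- **Lemma 4.7(ii) (elastic observability-type inequality).**  Full Dirichlet
boundary conditions.  If `U ∈ D(𝒜)` satisfies the resolvent equation
`iλU − 𝒜U = Û`, then with `𝓙(ψ) = |ψx(0)|² + |ψx(L)|²` one has
`𝓙(ψ) ≤ c‖U‖²_ℋ + c‖U‖_ℋ‖Û‖_ℋ + c‖U‖_ℋ‖ξx‖` for some structural constant
`c > 0` independent of `λ`, `U` and `Û`. -/
theorem elastic_observability_J (P : Params) :
    ∃ c : ℝ, 0 < c ∧ ∀ (lam : ℝ) (U Uhat : State),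
      memDomA P BC.dirichlet U → memHS P BC.dirichlet Uhat →
      resolventEq P lam U Uhat →
      Jterm P U ≤ c * hnormSq P U + c * hnorm P U * hnorm P Uhat +
        c * hnorm P U * L2norm P.L (deriv U.xi) := by
  set K := embedConst P with hKdef
  have hK : 0 ≤ K := embedConst_nonneg P
  have hL := P.hL
  have hk := P.hk
  have hb := P.hb
  have hg := P.hgamma
  have hs := P.hsigma
  have hr := P.hrho2
  set C := 1 + P.L * (P.k + P.gamma) * K ^ 2 + P.L * P.sigma * K + 2 * P.L * P.rho2 * K ^ 2
    with hC
  have hCpos : 0 < C := by positivity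
  refine ⟨C / (P.L / 2 * P.b), by positivity, fun lam U Uhat hU hUhat hres => ?_⟩
  have hJ := Jterm_le P hU hUhat hres
  have hN : 0 ≤ hnorm P U := Real.sqrt_nonneg _
  have hM : 0 ≤ hnorm P Uhat := Real.sqrt_nonneg _
  have hX : 0 ≤ L2norm P.L (deriv U.xi) := L2norm_nonneg _ _
  have hNsq : hnormSq P U = hnorm P U ^ 2 := (Real.sq_sqrt (hnormSq_nonneg P U)).symm
  have hE := (component_le_hnormSq P U).2.2.2.2
  obtain ⟨he, hz, hp, ht⟩ := L2norm_le_embedConst P U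
  obtain ⟨-, hF, hG, -⟩ := L2norm_le_embedConst P Uhat
  rw [← hKdef] at he hz hp ht hF hG
  rw [hNsq] at hE ⊢
  set N := hnorm P U
  set M := hnorm P Uhat
  set X := L2norm P.L (deriv U.xi)
  have hKN : 0 ≤ K * N := mul_nonneg hK hN
  have hKM : 0 ≤ K * M := mul_nonneg hK hM
  have hbound : P.L / 2 * (P.b * Jterm P U) ≤ N ^ 2 +
      P.L * (P.k * ((K * N) * (K * N)) + P.gamma * ((K * N) * (K * N)) +
        P.sigma * (X * (K * N)) + P.rho2 * ((K * M) * (K * N)) +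
        P.rho2 * ((K * N) * (K * M))) := by
    refine hJ.trans (add_le_add hE ?_)
    have := L2norm_nonneg P.L (deriv U.psi)
    have := L2norm_nonneg P.L (deriv Uhat.psi)
    gcongr
  have hC1 : 1 + P.L * (P.k + P.gamma) * K ^ 2 ≤ C := by
    rw [hC]
    have : 0 ≤ P.L * P.sigma * K + 2 * P.L * P.rho2 * K ^ 2 := by positivity
    linarith
  have hC2 : 2 * P.L * P.rho2 * K ^ 2 ≤ C := by
    rw [hC]
    have : 0 ≤ 1 + P.L * (P.k + P.gamma) * K ^ 2 + P.L * P.sigma * K := by positivity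
    linarith
  have hC3 : P.L * P.sigma * K ≤ C := by
    rw [hC]
    have : 0 ≤ 1 + P.L * (P.k + P.gamma) * K ^ 2 + 2 * P.L * P.rho2 * K ^ 2 := by positivity
    linarith
  have m1 := mul_le_mul_of_nonneg_right hC1 (sq_nonneg N)
  have m2 := mul_le_mul_of_nonneg_right hC2 (mul_nonneg hN hM)
  have m3 := mul_le_mul_of_nonneg_right hC3 (mul_nonneg hN hX)
  have hfin : C / (P.L / 2 * P.b) * N ^ 2 + C / (P.L / 2 * P.b) * N * M +
      C / (P.L / 2 * P.b) * N * X = (C * N ^ 2 + C * (N * M) + C * (N * X)) / (P.L / 2 * P.b) := by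
    ring
  rw [hfin, le_div_iff₀ (by positivity)]
  linarith

end TGP
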